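/- With K, F, Q defined as above relative to a fixed volume form on ℝ⁶, every 3-form φ satisfies F(F(φ)) = −Q(φ)²·φ. -/

import Mathlib

noncomputable section

/-- The model 6-dimensional real vector space. -/
abbrev V6 := Fin 6 → ℝ

/-- Alternating k-forms on V6. -/
abbrev Form (k : ℕ) := AlternatingMap ℝ V6 ℝ (Fin k)

/-- Wedge product of alternating forms (determinant convention). -/
noncomputable def wedge {a b : ℕ} (φ : Form a) (ψ : Form b) : Form (a + b) :=
  AlternatingMap.domDomCongr finSumFinEquiv
    ((TensorProduct.lid ℝ ℝ).toLinearMap.compAlternatingMap (AlternatingMap.domCoprod φ ψ))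

infixl:70 " ⋏ " => wedge

/-- Interior product (contraction) of a form with a vector. -/
noncomputable def iota (v : V6) {k : ℕ} (φ : Form (k + 1)) : Form k :=
  AlternatingMap.curryLeft φ v

/-- The standard dual basis 1-forms e¹, …, e⁶ (0-indexed). -/
noncomputable def e (i : Fin 6) : Form 1 :=
  AlternatingMap.ofSubsingleton ℝ V6 ℝ 0 (LinearMap.proj i)

/-- The standard basis vectors e₁, …, e₆ (0-indexed). -/
def b (i : Fin 6) : V6 := Pi.single i 1

/-- The standard volume form e¹∧e²∧e³∧e⁴∧e⁵∧e⁶. -/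
noncomputable def vol : Form 6 := e 0 ⋏ e 1 ⋏ e 2 ⋏ e 3 ⋏ e 4 ⋏ e 5

/-- The wedge product as a signed sum over any system `f` of representatives of the cosets of
`Perm (Fin a) × Perm (Fin b)`. -/
theorem wedge_apply_eq_sum {a b : ℕ} {ι : Type*} [Fintype ι]
    (f : ι → Equiv.Perm (Fin a ⊕ Fin b))
    (hcard : Fintype.card ι * (a.factorial * b.factorial) = (a + b).factorial)
    (hinj : ∀ i j, (∀ k, (((f i)⁻¹ * f j) (Sum.inl k)).isLeft = true) → i = j)
    (φ : Form a) (ψ : Form b) (v : Fin (a + b) → V6) :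
    (φ ⋏ ψ) v = ∑ i, ((f i).sign : ℤ) •
      (φ (fun k => v (finSumFinEquiv (f i (Sum.inl k)))) *
        ψ (fun k => v (finSumFinEquiv (f i (Sum.inr k))))) := by
  classical
  have hbij : Function.Bijective
      (fun i => (QuotientGroup.mk (f i) : Equiv.Perm.ModSumCongr (Fin a) (Fin b))) := by
    rw [Fintype.bijective_iff_injective_and_card]
    constructor
    · intro i j hij
      obtain ⟨⟨s, t⟩, hst⟩ := QuotientGroup.eq.1 hij
      refine hinj i j fun k => ?_
      rw [← hst]
      simp
    · have h := Subgroup.card_eq_card_quotient_mul_card_subgroup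
        (Equiv.Perm.sumCongrHom (Fin a) (Fin b)).range
      rw [← Nat.card_congr (MonoidHom.ofInjective
        Equiv.Perm.sumCongrHom_injective).toEquiv] at h
      simp only [Nat.card_eq_fintype_card, Fintype.card_perm, Fintype.card_sum,
        Fintype.card_fin, Fintype.card_prod] at h
      rw [← hcard] at h
      exact Nat.eq_of_mul_eq_mul_right (by positivity) h
  simp only [wedge, AlternatingMap.domDomCongr_apply, LinearMap.compAlternatingMap_apply,
    AlternatingMap.domCoprod_apply, sum_apply, map_sum]
  rw [← hbij.sum_comp]
  refine Finset.sum_congr rfl fun i _ => ?_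
  erw [AlternatingMap.domCoprod.summand_mk'']
  rcases Int.units_eq_one_or (Equiv.Perm.sign (f i)) with h | h <;> simp [h, Function.comp_def]

theorem Form.map_comp_two {n : ℕ} (ω : Form 2) (x : Fin n → V6) (g : Fin 2 → Fin n) :
    ω (fun k => x (g k)) = ω ![x (g 0), x (g 1)] :=
  congrArg ω (by ext i : 1; fin_cases i <;> rfl)

theorem Form.map_comp_three {n : ℕ} (φ : Form 3) (x : Fin n → V6) (g : Fin 3 → Fin n) :
    φ (fun k => x (g k)) = φ ![x (g 0), x (g 1), x (g 2)] :=
  congrArg φ (by ext i : 1; fin_cases i <;> rfl)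

open Equiv in
theorem wedge_two_three_apply (ω : Form 2) (φ : Form 3) (x : Fin 5 → V6) :
    (ω ⋏ φ) x =
      ω ![x 0, x 1] * φ ![x 2, x 3, x 4] - ω ![x 2, x 1] * φ ![x 0, x 3, x 4]
      - ω ![x 3, x 1] * φ ![x 2, x 0, x 4] - ω ![x 4, x 1] * φ ![x 2, x 3, x 0]
      - ω ![x 0, x 2] * φ ![x 1, x 3, x 4] - ω ![x 0, x 3] * φ ![x 2, x 1, x 4]
      - ω ![x 0, x 4] * φ ![x 2, x 3, x 1] + ω ![x 2, x 3] * φ ![x 0, x 1, x 4]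
      + ω ![x 2, x 4] * φ ![x 0, x 3, x 1] + ω ![x 3, x 4] * φ ![x 2, x 0, x 1] := by
  let s (i : Fin 2) (j : Fin 3) : Perm (Fin 2 ⊕ Fin 3) := swap (Sum.inl i) (Sum.inr j)
  have hs (i j) : (s i j).sign = -1 := Perm.sign_swap (by simp)
  rw [wedge_apply_eq_sum ![
      1, s 0 0, s 0 1, s 0 2, s 1 0,
      s 1 1, s 1 2, s 0 0 * s 1 1, s 0 0 * s 1 2, s 0 1 * s 1 2]
    (by decide) (by decide +kernel)]
  simp only [Fin.sum_univ_succ, Form.map_comp_two, Form.map_comp_three]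
  simp [hs]
  simp [s, swap_apply_def, finSumFinEquiv]
  ring

open Equiv in
theorem wedge_three_three_apply (φ : Form 3) (ψ : Form 3) (x : Fin 6 → V6) :
    (φ ⋏ ψ) x =
      φ ![x 0, x 1, x 2] * ψ ![x 3, x 4, x 5] - φ ![x 3, x 1, x 2] * ψ ![x 0, x 4, x 5]
      - φ ![x 4, x 1, x 2] * ψ ![x 3, x 0, x 5] - φ ![x 5, x 1, x 2] * ψ ![x 3, x 4, x 0]
      - φ ![x 0, x 3, x 2] * ψ ![x 1, x 4, x 5] - φ ![x 0, x 4, x 2] * ψ ![x 3, x 1, x 5]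
      - φ ![x 0, x 5, x 2] * ψ ![x 3, x 4, x 1] - φ ![x 0, x 1, x 3] * ψ ![x 2, x 4, x 5]
      - φ ![x 0, x 1, x 4] * ψ ![x 3, x 2, x 5] - φ ![x 0, x 1, x 5] * ψ ![x 3, x 4, x 2]
      + φ ![x 3, x 4, x 2] * ψ ![x 0, x 1, x 5] + φ ![x 3, x 5, x 2] * ψ ![x 0, x 4, x 1]
      + φ ![x 4, x 5, x 2] * ψ ![x 3, x 0, x 1] + φ ![x 3, x 1, x 4] * ψ ![x 0, x 2, x 5]
      + φ ![x 3, x 1, x 5] * ψ ![x 0, x 4, x 2] + φ ![x 4, x 1, x 5] * ψ ![x 3, x 0, x 2]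
      + φ ![x 0, x 3, x 4] * ψ ![x 1, x 2, x 5] + φ ![x 0, x 3, x 5] * ψ ![x 1, x 4, x 2]
      + φ ![x 0, x 4, x 5] * ψ ![x 3, x 1, x 2] - φ ![x 3, x 4, x 5] * ψ ![x 0, x 1, x 2] := by
  let s (i : Fin 3) (j : Fin 3) : Perm (Fin 3 ⊕ Fin 3) := swap (Sum.inl i) (Sum.inr j)
  have hs (i j) : (s i j).sign = -1 := Perm.sign_swap (by simp)
  rw [wedge_apply_eq_sum ![
      1, s 0 0, s 0 1, s 0 2, s 1 0,
      s 1 1, s 1 2, s 2 0, s 2 1, s 2 2,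
      s 0 0 * s 1 1, s 0 0 * s 1 2, s 0 1 * s 1 2, s 0 0 * s 2 1, s 0 0 * s 2 2,
      s 0 1 * s 2 2, s 1 0 * s 2 1, s 1 0 * s 2 2, s 1 1 * s 2 2, s 0 0 * s 1 1 * s 2 2]
    (by decide) (by decide +kernel)]
  simp only [Fin.sum_univ_succ, Form.map_comp_three]
  simp [hs]
  simp [s, swap_apply_def, finSumFinEquiv]
  ring

attribute [local irreducible] wedge

open Equiv in
theorem wedge_one_apply_of_eq_zero {n : ℕ} (ω : Form n) (ψ : Form 1) (x : Fin (n + 1) → V6)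
    (h : ∀ i : Fin n, ψ ![x i.castSucc] = 0) :
    (ω ⋏ ψ) x = ω (fun i => x i.castSucc) * ψ ![x (Fin.last n)] := by
  have hψ (y : Fin 1 → V6) : ψ y = ψ ![y 0] := congrArg ψ (by ext i : 1; fin_cases i; rfl)
  rw [wedge_apply_eq_sum (fun i : Option (Fin n) =>
    i.elim 1 fun i => swap (Sum.inl i) (Sum.inr 0)) (by simp [Nat.factorial_succ])]
  · rw [Fintype.sum_option, Finset.sum_eq_zero]
    · rw [hψ]
      simp [Fin.castAdd, Fin.castSucc, Fin.natAdd, Fin.last]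
    · intro i _
      rw [hψ (fun k => _)]
      simpa [Fin.castSucc] using Or.inr (h i)
  · rintro (_ | i) (_ | j) hij
    · rfl
    · simpa using hij j
    · simpa using hij i
    · by_contra hne
      have hne : i ≠ j := by rintro rfl; exact hne rfl
      simpa [swap_apply_of_ne_of_ne, hne] using hij i

theorem vol_ne_zero : vol ≠ 0 := by
  intro h
  have he (i : Fin 6) (v : V6) : e i ![v] = v i := by simp [e]
  have hvol : vol b = 1 := by
    unfold vol
    iterate 5
      rw [wedge_one_apply_of_eq_zero _ _ _ fun i => by
        rw [he]; exact Pi.single_eq_of_ne (by revert i; decide) _]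
    simp [e, b]
  simp [h] at hvol

theorem vol_apply_ne_zero {x : Fin 6 → V6} (hx : LinearIndependent ℝ x) : vol x ≠ 0 := by
  have h := (AlternatingMap.map_basis_ne_zero_iff
    (basisOfLinearIndependentOfCardEqFinrank hx (by simp)) vol).2 vol_ne_zero
  simpa using h

theorem exists_vol_cons_ne_zero {v w : V6} (h : LinearIndependent ℝ ![v, w]) :
    ∃ x : Fin 4 → V6, vol ![v, w, x 0, x 1, x 2, x 3] ≠ 0 := by
  obtain ⟨x₃, h⟩ := exists_linearIndependent_cons_of_lt_finrank h (by simp)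
  obtain ⟨x₂, h⟩ := exists_linearIndependent_cons_of_lt_finrank h (by simp)
  obtain ⟨x₁, h⟩ := exists_linearIndependent_cons_of_lt_finrank h (by simp)
  obtain ⟨x₀, h⟩ := exists_linearIndependent_cons_of_lt_finrank h (by simp)
  have hperm : Fin.cons x₀ (Fin.cons x₁ (Fin.cons x₂ (Fin.cons x₃ ![v, w]))) ∘
      ![4, 5, 0, 1, 2, 3] = ![v, w, x₀, x₁, x₂, x₃] := by
    ext i : 1
    fin_cases i <;> rfl
  exact ⟨![x₀, x₁, x₂, x₃], vol_apply_ne_zero (hperm ▸ h.comp _ (by decide))⟩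

theorem iota_apply (v : V6) {k : ℕ} (φ : Form (k + 1)) (x : Fin k → V6) :
    iota v φ x = φ (Matrix.vecCons v x) := rfl

theorem iota_smul (c : ℝ) (v : V6) {k : ℕ} (φ : Form (k + 1)) : iota (c • v) φ = c • iota v φ :=
  map_smul (AlternatingMap.curryLeft φ) c v

theorem iota_sub (v w : V6) {k : ℕ} (φ : Form (k + 1)) : iota (v - w) φ = iota v φ - iota w φ :=
  map_sub (AlternatingMap.curryLeft φ) v w

theorem eq_of_iota_vol_eq {v w : V6} (h : iota v vol = iota w vol) : v = w := by
  by_contra hne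
  have hne : v - w ≠ 0 := sub_ne_zero.2 hne
  obtain ⟨u, hu⟩ := exists_linearIndependent_pair_of_one_lt_finrank (R := ℝ) (by simp) hne
  obtain ⟨x, hx⟩ := exists_vol_cons_ne_zero hu
  rw [← iota_apply, iota_sub, h, sub_self] at hx
  exact hx rfl

theorem smul_wedge (c : ℝ) (ω : Form 2) (φ : Form 3) : (c • ω) ⋏ φ = c • (ω ⋏ φ) := by
  ext x
  simp only [wedge_two_three_apply, AlternatingMap.smul_apply, smul_eq_mul]
  ring

theorem Form.map_swap_zero_one (φ : Form 3) {n : ℕ} (y : Fin n → V6) {i j : Fin n}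
    (_ : i < j) (k : Fin n) : φ ![y j, y i, y k] = -φ ![y i, y j, y k] := by
  rw [← φ.map_swap _ (show (0 : Fin 3) ≠ 1 by decide)]
  congr 1
  ext i : 1
  fin_cases i <;> rfl

theorem Form.map_swap_one_two (φ : Form 3) {n : ℕ} (y : Fin n → V6) {i j : Fin n}
    (_ : i < j) (k : Fin n) : φ ![y k, y j, y i] = -φ ![y k, y i, y j] := by
  rw [← φ.map_swap _ (show (1 : Fin 3) ≠ 2 by decide)]
  congr 1
  ext i : 1
  fin_cases i <;> rfl

/-- If `ι_w ι_v φ = 0` with `v = y 0` and `w = y 1`, then contracting `ι_v φ ∧ φ` with `w` agrees with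
contracting `ι_w φ ∧ φ` with `v`. -/
theorem iota_wedge_self_comm (φ : Form 3) (y : Fin 6 → V6)
    (h : ∀ k, φ ![y 0, y 1, y k] = 0) :
    (iota (y 0) φ ⋏ φ) ![y 1, y 2, y 3, y 4, y 5] =
      (iota (y 1) φ ⋏ φ) ![y 0, y 2, y 3, y 4, y 5] := by
  simp only [wedge_two_three_apply, iota_apply, Matrix.cons_val]
  simp (disch := decide) only [Form.map_swap_zero_one φ y, Form.map_swap_one_two φ y, h]
  ring

/-- The Leibniz rule for the interior product on a wedge of two 3-forms. -/
theorem wedge_apply_eq_iota_sub (φ ψ : Form 3) (y : Fin 6 → V6) :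
    (φ ⋏ ψ) y = (iota (y 0) φ ⋏ ψ) ![y 1, y 2, y 3, y 4, y 5] -
      (iota (y 0) ψ ⋏ φ) ![y 1, y 2, y 3, y 4, y 5] := by
  simp only [wedge_two_three_apply, wedge_three_three_apply, iota_apply, Matrix.cons_val]
  simp (disch := decide) only [Form.map_swap_zero_one _ y, Form.map_swap_one_two _ y]
  ring

/-- An evaluated form of `∑ eⁱ ∧ ι_{eᵢ} ψ = 3 ψ`, wedged with `φ`. -/
theorem sum_iota_wedge_apply (φ ψ : Form 3) (y : Fin 6 → V6) :
    ∑ i : Fin 6, (-1) ^ (i : ℕ) * (iota (y i) ψ ⋏ φ) (fun k => y (i.succAbove k)) =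
      -3 * (φ ⋏ ψ) y := by
  simp only [Fin.sum_univ_succ, wedge_two_three_apply, wedge_three_three_apply, iota_apply]
  simp [Fin.succAbove]
  simp (disch := decide) only [Form.map_swap_zero_one _ y, Form.map_swap_one_two _ y]
  ring

theorem neg_one_pow_mul_iota_apply_succAbove {n : ℕ} (φ : Form (n + 1)) (y : Fin (n + 1) → V6)
    (i : Fin (n + 1)) : (-1) ^ (i : ℕ) * iota (y i) φ (fun k => y (i.succAbove k)) = φ y := by
  have hy : Matrix.vecCons (y i) (fun k => y (i.succAbove k)) = y ∘ i.cycleRange.symm := by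
    ext k : 1
    cases k using Fin.cases <;> simp
  rw [iota_apply, hy, AlternatingMap.map_perm, Equiv.Perm.sign_symm, Fin.sign_cycleRange]
  simp [Units.smul_def, ← mul_assoc, ← pow_add, ← two_mul]

/-- The endomorphism `K` squares to a scalar: symmetry of `φ (K ·, ·, ·)` forces `K (K v)` to be
proportional to `v`. -/
theorem exists_comp_self_eq_smul_one {φ F : Form 3} {K : V6 →ₗ[ℝ] V6}
    (hK : ∀ v : V6, iota (K v) vol = -(iota v φ ⋏ φ))
    (hF : ∀ v : V6, iota v F = (-2 : ℝ) • iota (K v) φ) :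
    ∃ μ : ℝ, K * K = μ • 1 := by
  refine LinearMap.exists_eq_smul_id_of_forall_notLinearIndependent fun v hv => ?_
  obtain ⟨x, hx⟩ := exists_vol_cons_ne_zero (LinearIndependent.pair_symm_iff.1 hv)
  have hsymm (u : V6) : φ ![K v, v, u] = 0 := by
    have hFv : F ![v, v, u] = 0 :=
      F.map_eq_zero_of_eq _ (i := 0) (j := 1) rfl (by decide)
    have h := congrArg (fun ω : Form 2 => ω ![v, u]) (hF v)
    simpa [iota_apply, hFv] using h
  have hcomm := iota_wedge_self_comm φ ![K v, v, x 0, x 1, x 2, x 3] fun k => hsymm _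
  simp only [Matrix.cons_val] at hcomm
  have hvol : vol ![K v, K v, x 0, x 1, x 2, x 3] = 0 :=
    vol.map_eq_zero_of_eq _ (i := 0) (j := 1) rfl (by decide)
  rw [← iota_apply, hK, AlternatingMap.neg_apply] at hvol
  apply hx
  rw [Module.End.mul_apply, ← iota_apply, hK, AlternatingMap.neg_apply, hcomm]
  exact hvol

/-- With K, F, Q as in the paper (relative to the fixed volume form), every 3-form
φ satisfies F(F(φ)) = −Q(φ)²·φ. -/
theorem F_of_F (φ F FF : Form 3) (K KF : V6 →ₗ[ℝ] V6) (Q : ℝ)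
    (hK : ∀ v : V6, iota (K v) vol = -(iota v φ ⋏ φ))
    (hF : ∀ v : V6, iota v F = (-2 : ℝ) • iota (K v) φ)
    (hQ : (φ ⋏ F : Form 6) = (-Q) • vol)
    (hKF : ∀ v : V6, iota (KF v) vol = -(iota v F ⋏ F))
    (hFF : ∀ v : V6, iota v FF = (-2 : ℝ) • iota (KF v) F) :
    FF = (-(Q ^ 2)) • φ := by
  obtain ⟨μ, hμ⟩ := exists_comp_self_eq_smul_one hK hF
  have hKK (v : V6) : K (K v) = μ • v := LinearMap.congr_fun hμ v
  have hFφ (v : V6) : iota v F ⋏ φ = (2 * μ) • iota v vol := by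
    rw [hF, smul_wedge, ← neg_eq_iff_eq_neg.2 (hK (K v)), hKK, iota_smul, smul_neg, ← neg_smul,
      smul_smul]
    norm_num
  have hQμ : Q = 4 * μ := by
    obtain ⟨y, hy⟩ : ∃ y, vol y ≠ 0 := by
      by_contra! h
      exact vol_ne_zero (AlternatingMap.ext h)
    have h := sum_iota_wedge_apply φ F y
    simp only [hFφ, hQ, AlternatingMap.smul_apply, smul_eq_mul, mul_left_comm _ (2 * μ),
      neg_one_pow_mul_iota_apply_succAbove] at h
    simp only [Finset.sum_const, Finset.card_univ, Fintype.card_fin, nsmul_eq_mul] at h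
    apply mul_right_cancel₀ hy
    push_cast at h
    linarith
  have hφF (v : V6) : iota v φ ⋏ F = (-(2 * μ)) • iota v vol := by
    refine AlternatingMap.ext fun (x : Fin 5 → V6) => ?_
    have hx : ![x 0, x 1, x 2, x 3, x 4] = x := by ext i : 1; fin_cases i <;> rfl
    have h := wedge_apply_eq_iota_sub φ F ![v, x 0, x 1, x 2, x 3, x 4]
    simp only [Matrix.cons_val] at h
    rw [hx, hFφ, hQ, hQμ] at h
    simp only [AlternatingMap.smul_apply, smul_eq_mul, iota_apply] at h ⊢
    linarith
  have hKF' (v : V6) : KF v = (-(4 * μ)) • K v := by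
    apply eq_of_iota_vol_eq
    rw [hKF, hF, smul_wedge, hφF, iota_smul, smul_smul, ← neg_smul]
    congr 1
    ring
  ext x
  have h : iota (x 0) FF = (-(Q ^ 2)) • iota (x 0) φ := by
    rw [hFF, hKF', iota_smul, hF, hKK, iota_smul, hQμ]
    simp only [smul_smul]
    congr 1
    ring
  have hx : Matrix.vecCons (x 0) (fun i => x i.succ) = x := Matrix.cons_head_tail x
  simpa only [iota_apply, AlternatingMap.smul_apply, hx] using
    congrArg (fun ω : Form 2 => ω fun i => x i.succ) h
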